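/- Let m and t be positive integers with C(t−1,3) ≤ m ≤ C(t−1,3) + C(t−2,2). Let G be a left-compressed 3-uniform hypergraph on vertex set [t] with m edges not containing a clique of order t−1, and suppose |E_{(t−1)t}| ≤ 3, where E_{(t−1)t} = {i : i(t−1)t ∈ E}. Then λ(G) < λ([t−1]^{(3)}). -/

import Mathlib

open Finset

/-- The polynomial λ(G, w) = Σ_{e ∈ E} Π_{i ∈ e} w i. -/
def lagPoly (E : Finset (Finset ℕ)) (w : ℕ → ℝ) : ℝ :=
  ∑ e ∈ E, ∏ i ∈ e, w i

/-- A feasible weighting on vertex set [n] = {0, …, n-1}. -/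
def IsWeighting (n : ℕ) (w : ℕ → ℝ) : Prop :=
  (∀ i, 0 ≤ w i) ∧ (∀ i, n ≤ i → w i = 0) ∧ ∑ i ∈ Finset.range n, w i = 1

/-- The Lagrangian of a hypergraph with edge set `E`. -/
noncomputable def lag (E : Finset (Finset ℕ)) : ℝ :=
  sSup {x | ∃ n w, IsWeighting n w ∧ x = lagPoly E w}

/-- The complete r-uniform hypergraph on vertex set {0, …, t-1}. -/
def completeG (t r : ℕ) : Finset (Finset ℕ) :=
  (Finset.range t).powersetCard r

/-- A hypergraph is left-compressed if replacing any vertex of an edge by a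
smaller vertex (not already in the edge) again yields an edge. -/
def LeftCompressed (E : Finset (Finset ℕ)) : Prop :=
  ∀ e ∈ E, ∀ j ∈ e, ∀ i < j, i ∉ e → insert i (e.erase j) ∈ E

def gg (n y : ℝ) : ℝ := (y-1)^2*(3*n-4-2*y)

lemma gg_nonneg {n y : ℝ} (hn : 4 ≤ n) (hy : y ≤ n) : 0 ≤ gg n y := by
  unfold gg; exact mul_nonneg (sq_nonneg _) (by linarith)

lemma crude {n A B Z S : ℝ} (hS : 0 ≤ S) (h : S ≤ n - (A+B+Z)) :
    3*gg n ((A+B+Z)/3) + 6*((A+B+Z)/3)^3 - 9/4*((A+B+Z)/3)^2*S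
     ≤ gg n A + gg n B + gg n Z + 6*A*B*Z - 3/2*Z^2*S := by
  have e : gg n A + gg n B + gg n Z + 6*A*B*Z - 3/2*Z^2*S - (3*gg n ((A+B+Z)/3) + 6*((A+B+Z)/3)^3 - 9/4*((A+B+Z)/3)^2*S) = (n - (A+B+Z) - S) * ((A-B)^2 + (B-Z)^2+(A-Z)^2) + S * (3/2*(A-B)^2 + 3*(Z-(A+B+Z)/2)^2) := by
    unfold gg; ring
  have h1 : 0 ≤ (n - (A+B+Z) - S) * ((A-B)^2 + (B-Z)^2+(A-Z)^2) := mul_nonneg (by linarith) (by positivity)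
  have h2 : 0 ≤ S * (3/2*(A-B)^2 + 3*(Z-(A+B+Z)/2)^2) := by positivity
  linarith

lemma two1 {r Y : ℝ} (hr : 0 ≤ r) (hY : 0 ≤ Y) (h : Y + 3*r = 4) :
    1/100 ≤ gg 4 Y + 3*gg 4 r + 6*r^3 - 9/4*r^2*Y := by
  obtain rfl : Y = 4 - 3*r := by linarith
  unfold gg
  nlinarith [mul_nonneg hr hY, mul_nonneg hr (sq_nonneg (r-1)), mul_nonneg hY (sq_nonneg (r-1)), sq_nonneg (r-1), mul_nonneg hr (mul_nonneg hr hY)]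

lemma two2 {n r Y : ℝ} (hn : 5 ≤ n) (hr : 0 ≤ r) (hY : 0 ≤ Y) (h : 2*Y + 3*r ≤ n) :
    1/100 ≤ 2*gg n Y + 3*gg n r + 6*r^3 - 9/2*r^2*Y := by
  have gY : (Y-1)^2*6 ≤ gg n Y := by
    unfold gg; exact mul_le_mul_of_nonneg_left (by linarith) (sq_nonneg _)
  have gr : (r-1)^2*(23/3) ≤ gg n r := by
    unfold gg; exact mul_le_mul_of_nonneg_left (by linarith) (sq_nonneg _)
  by_cases h2 : r ≤ 2
  · have h1 : 0 ≤ r^3*(2-r) := mul_nonneg (by positivity) (by linarith)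
    have h3 : 1/100 ≤ 23*(r-1)^2 + (6-27/32)*r^3 - 9/2*r^2 := by
      nlinarith [mul_nonneg hr (sq_nonneg (r-9/10)), sq_nonneg (r-9/10)]
    nlinarith [sq_nonneg (Y-1-3/16*r^2)]
  · push Not at h2
    by_cases h4 : Y ≤ 4/3*r
    · have : 0 ≤ r^2*(4/3*r - Y) := mul_nonneg (sq_nonneg _) (by linarith)
      nlinarith [sq_nonneg (Y-1)]
    · push Not at h4
      have g2 : (Y-1)^2*(9*r) ≤ gg n Y := by
        unfold gg; exact mul_le_mul_of_nonneg_left (by linarith) (sq_nonneg _)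
      have h5 : 3/8*Y^2 ≤ (Y-1)^2 := by nlinarith
      have h6 : 3/8*Y^2*(9*r) ≤ (Y-1)^2*(9*r) := mul_le_mul_of_nonneg_right h5 (by linarith)
      have h7 : 0 ≤ Y*r*(Y-4/3*r) := mul_nonneg (by positivity) (by linarith)
      have h8 : 0 ≤ r^3 := by positivity
      have h9 : 0 ≤ r^2*Y := by positivity
      nlinarith [sq_nonneg (Y-1)]

lemma avg2 {n a b : ℝ} (h : a + b ≤ n) : 2*gg n ((a+b)/2) ≤ gg n a + gg n b := by
  have : gg n a + gg n b - 2*gg n ((a+b)/2) = (a-b)^2/4 * (6*(n-(a+b))) := by unfold gg; ring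
  have : 0 ≤ (a-b)^2/4 * (6*(n-(a+b))) := mul_nonneg (by positivity) (by linarith)
  linarith

lemma avg3 {n a b c : ℝ} (ha : 0 ≤ a) (hb : 0 ≤ b) (hc : 0 ≤ c) (h : a + b + c ≤ n) :
    3*gg n ((a+b+c)/3) ≤ gg n a + gg n b + gg n c := by
  have e : gg n a + gg n b + gg n c - 3*gg n ((a+b+c)/3) =
    (n-(a+b+c)) * ((a-b)^2+(b-c)^2+(a-c)^2) + 
    (gg (a+b+c) a + gg (a+b+c) b + gg (a+b+c) c - 3*gg (a+b+c) ((a+b+c)/3)) := by unfold gg; ring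
  have h1 : 0 ≤ (n-(a+b+c)) * ((a-b)^2+(b-c)^2+(a-c)^2) := mul_nonneg (by linarith) (by positivity)
  have h2 : 0 ≤ gg (a+b+c) a + gg (a+b+c) b + gg (a+b+c) c - 3*gg (a+b+c) ((a+b+c)/3) := by
    unfold gg
    nlinarith [mul_nonneg ha (sq_nonneg (b-c)), mul_nonneg hb (sq_nonneg (a-c)), mul_nonneg hc (sq_nonneg (a-b)),mul_nonneg ha (sq_nonneg (a-c)), mul_nonneg ha (sq_nonneg (a-b)),mul_nonneg hb (sq_nonneg (b-c)),mul_nonneg hb (sq_nonneg (b-a)), mul_nonneg hc (sq_nonneg (c-b)), mul_nonneg hc (sq_nonneg (c-a))]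
  linarith

lemma gmin {n a : ℝ} (hn : 7 ≤ n) (ha' : a ≤ n) :
    15*(min a 1 - 1)^2 ≤ gg n a := by
  rcases le_total a 1 with h | h
  · rw [min_eq_left h]; unfold gg; nlinarith [sq_nonneg (a-1)]
  · rw [min_eq_right h]; simp; exact gg_nonneg (by linarith) ha'

lemma hZ {n a B Z : ℝ} (hn : 7 ≤ n) (ha : 0 ≤ a) (hB : 0 ≤ B) (han : a ≤ n) (hBn : B ≤ n)
    (hZ : 0 ≤ Z) (hZ4 : Z ≤ 4) : 36/5*Z - 6/5*Z^2 ≤ gg n a + gg n B + 15/2*a*B*Z := by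
  have h1 := gmin hn han
  have h2 := gmin hn hBn
  have h3 : min a 1 * min B 1 ≤ a * B := mul_le_mul (min_le_left _ _) (min_le_left _ _) (le_min hB (by norm_num)) ha
  have h4 : min a 1 * min B 1 * Z ≤ a * B * Z := mul_le_mul_of_nonneg_right h3 hZ
  set x := min a 1
  set y := min B 1
  have : 36/5*Z - 6/5*Z^2 ≤ 15*(x-1)^2 + 15*(y-1)^2 + 15/2*(x*y*Z) := by
    nlinarith [mul_nonneg hZ (sq_nonneg ((x+y)/2-4/5)), mul_nonneg (sub_nonneg.2 hZ4) (sq_nonneg (x-y)), sq_nonneg ((x+y)/2 - 1 + Z/5)]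
  linarith

lemma core3 {n Y a B Z : ℝ} (hn : 7 ≤ n) (hY : 0 ≤ Y) (ha : 0 ≤ a) (hB : 0 ≤ B) (h0 : 0 ≤ Z)
    (h : 3*Y + a + B + Z ≤ n) :
    1/100 ≤ 3*gg n Y + gg n a + gg n B + gg n Z + 15/2*a*B*Z - 9/2*Z^2*Y := by
  have gY : (Y-1)^2*12 ≤ gg n Y := by
    unfold gg; exact mul_le_mul_of_nonneg_left (by linarith) (sq_nonneg _)
  have gZ1 : (Z-1)^2*(17-2*Z) ≤ gg n Z := by
    unfold gg; exact mul_le_mul_of_nonneg_left (by linarith) (sq_nonneg _)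
  have gZ2 : (Z-1)^2*(9*Y+Z-4) ≤ gg n Z := by
    unfold gg; exact mul_le_mul_of_nonneg_left (by linarith) (sq_nonneg _)
  by_cases h4 : Z ≤ 4
  · have h5 := hZ hn ha hB (by linarith) (by linarith) h0 h4
    by_cases h3 : Z ≤ 14/5
    · have h6 : 1/100 ≤ (Z-1)^2*(17-2*Z) + 36/5*Z - 57/10*Z^2-9/64*Z^4 := by
        have h7 : 0 ≤ (14/5 - Z) * Z^3 := mul_nonneg (by linarith) (by positivity)
        nlinarith [mul_nonneg h0 (sq_nonneg (Z-27/20)), sq_nonneg (Z-27/20), mul_nonneg h0 h0]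
      nlinarith [sq_nonneg (Y - 1 - Z^2/16)]
    · push Not at h3
      have h6 : 1/100 ≤ 36*(Y-1)^2 + gg n Z + 36/5*Z - 6/5*Z^2 - 9/2*Z^2*Y := by
        have he : 1/100 ≤ 36*((4-Z)/3)^2 + (Z-1)^2*(17-2*Z) + 36/5*Z - 6/5*Z^2 - 9/2*Z^2*((7-Z)/3) := by
          nlinarith [mul_nonneg (sub_nonneg.2 h3.le) (sub_nonneg.2 h4), mul_nonneg (mul_nonneg (sub_nonneg.2 h3.le) (sub_nonneg.2 h4)) h0]
        rcases le_total Y ((7-Z)/3) with hc | hc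
        · have : 0 ≤ ((7-Z)/3 - Y) * (9/2*Z^2 - 24*(4-Z)) := mul_nonneg (by linarith) (by nlinarith)
          nlinarith [sq_nonneg ((7-Z)/3 - Y)]
        · have : 0 ≤ (Y - (7-Z)/3) * (24*(4-Z) + 9*(Z-1)^2 - 9/2*Z^2) := mul_nonneg (by linarith) (by nlinarith [mul_nonneg (sub_nonneg.2 h3.le) (sub_nonneg.2 h4)])
          nlinarith [sq_nonneg ((7-Z)/3 - Y)]
      linarith
  · push Not at h4
    have g1 := gg_nonneg (n := n) (y := a) (by linarith) (by linarith)
    have g2 := gg_nonneg (n := n) (y := B) (by linarith) (by linarith)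
    have h6 : 0 ≤ 15/2*a*B*Z := by positivity
    have h7 : 9/16*Z^2 ≤ (Z-1)^2 := by nlinarith
    have h8 : 9/16*Z^2*(9*Y) ≤ (Z-1)^2*(9*Y) := mul_le_mul_of_nonneg_right h7 (by linarith)
    have h9 : 0 ≤ (Z-1)^2*(Z-4) := mul_nonneg (sq_nonneg _) (by linarith)
    have h10 : 0 ≤ (Z^2-16) * Y := mul_nonneg (by nlinarith) hY
    nlinarith [sq_nonneg (Y-1)]

/-- b = 3 inequality -/
lemma ineq3 {n Y1 Y2 Y3 A' A B P Q : ℝ} (hn : 7 ≤ n) (h1 : 0 ≤ Y1) (h2 : 0 ≤ Y2) (h3 : 0 ≤ Y3)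
    (hA' : 0 ≤ A') (hA : 0 ≤ A) (hB : 0 ≤ B) (hP : 0 ≤ P) (hQ : 0 ≤ Q)
    (h : Y1 + Y2 + Y3 + A' + A + B + (P + Q) ≤ n) :
    1/200 ≤ gg n Y1 + gg n Y2 + gg n Y3 + gg n A' + gg n A + gg n B + gg n (P+Q)
      + 6*(A*B*(P+Q) + A'*B*Q - P*Q*(Y1+Y2+Y3)) := by
  have a3 := avg3 (n := n) h1 h2 h3 (by linarith)
  have gA' := gg_nonneg (n := n) (y := A') (by linarith) (by linarith)
  have gA := gg_nonneg (n := n) (y := A) (by linarith) (by linarith)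
  have gB := gg_nonneg (n := n) (y := B) (by linarith) (by linarith)
  have gZ := gg_nonneg (n := n) (y := P+Q) (by linarith) (by linarith)
  have gY := gg_nonneg (n := n) (y := (Y1+Y2+Y3)/3) (by linarith) (by linarith)
  obtain ⟨Z, hZ⟩ : ∃ Z, Z = P + Q := ⟨_, rfl⟩
  obtain ⟨Y, hY⟩ : ∃ Y, Y = (Y1+Y2+Y3)/3 := ⟨_, rfl⟩
  have hS : Y1 + Y2 + Y3 = 3*Y := by linarith
  have hY0 : 0 ≤ Y := by rw [hY]; positivity
  have hZ0 : 0 ≤ Z := by rw [hZ]; positivity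
  rw [hS]
  rw [← hY] at a3 gY
  rw [← hZ] at gZ ⊢
  rcases le_total Q (Z/4) with hc | hc
  · have c := core3 (n := n) (Y := Y) (a := A) (B := B) (Z := Z) hn hY0 hA hB hZ0 (by linarith)
    have hPQ : P*Q ≤ 3/16*Z^2 := by
      obtain rfl : P = Z - Q := by linarith
      nlinarith [mul_nonneg (sub_nonneg.2 hc) hZ0, mul_nonneg (sub_nonneg.2 hc) (by linarith : 0 ≤ 3*Z/4 - Q)]
    have h5 : P*Q*Y ≤ 3/16*Z^2*Y := mul_le_mul_of_nonneg_right hPQ hY0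
    have h6 : 0 ≤ A'*B*Q := by positivity
    have h7 : 0 ≤ Z^2*Y := by positivity
    nlinarith
  · have hPQ : P*Q ≤ 1/4*Z^2 := by
      obtain rfl : P = Z - Q := by linarith
      nlinarith [sq_nonneg (Q - Z/2)]
    have h5 : P*Q*Y ≤ 1/4*Z^2*Y := mul_le_mul_of_nonneg_right hPQ hY0
    have h6 : A'*B*(Z/4) ≤ A'*B*Q := mul_le_mul_of_nonneg_left hc (by positivity)
    have hBZ : 0 ≤ B*Z := by positivity
    rcases le_total A A' with ha | ha
    · have c := core3 (n := n) (Y := Y) (a := A) (B := B) (Z := Z) hn hY0 hA hB hZ0 (by linarith)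
      nlinarith [mul_nonneg hBZ (sub_nonneg.2 ha)]
    · have c := core3 (n := n) (Y := Y) (a := A') (B := B) (Z := Z) hn hY0 hA' hB hZ0 (by linarith)
      nlinarith [mul_nonneg hBZ (sub_nonneg.2 ha)]

lemma ineq2 {n Y1 Y2 A B P Q : ℝ} (hn : 5 ≤ n) (h1 : 0 ≤ Y1) (h2 : 0 ≤ Y2)
    (hA : 0 ≤ A) (hB : 0 ≤ B) (hP : 0 ≤ P) (hQ : 0 ≤ Q)
    (h : Y1 + Y2 + A + B + (P + Q) ≤ n) :
    1/200 ≤ gg n Y1 + gg n Y2 + gg n A + gg n B + gg n (P+Q)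
      + 6*(A*B*(P+Q) - P*Q*(Y1+Y2)) := by
  have a2 := avg2 (n := n) (a := Y1) (b := Y2) (by linarith)
  have c := crude (n := n) (A := A) (B := B) (Z := P+Q) (S := Y1+Y2) (by linarith) (by linarith)
  have t := two2 (n := n) (r := (A+B+(P+Q))/3) (Y := (Y1+Y2)/2) hn (by positivity) (by positivity) (by linarith)
  have : 0 ≤ (P-Q)^2*(Y1+Y2) := by positivity
  nlinarith

lemma ineq1 {Y1 A B P Q : ℝ} (h1 : 0 ≤ Y1)
    (hA : 0 ≤ A) (hB : 0 ≤ B) (hP : 0 ≤ P) (hQ : 0 ≤ Q)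
    (h : Y1 + A + B + (P + Q) = 4) :
    1/200 ≤ gg 4 Y1 + gg 4 A + gg 4 B + gg 4 (P+Q)
      + 6*(A*B*(P+Q) - P*Q*Y1) := by
  have c := crude (n := 4) (A := A) (B := B) (Z := P+Q) (S := Y1) (by linarith) (by linarith)
  have t := two1 (r := (A+B+(P+Q))/3) (Y := Y1) (by positivity) (by positivity) (by linarith)
  have : 0 ≤ (P-Q)^2*Y1 := by positivity
  nlinarith

lemma lagPoly_succ (k N : ℕ) (Y : ℕ → ℝ) :
    lagPoly (powersetCard (k+1) (range (N+1))) Y =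
      lagPoly (powersetCard (k+1) (range N)) Y + Y N * lagPoly (powersetCard k (range N)) Y := by
  unfold lagPoly
  rw [Finset.range_add_one, Finset.powersetCard_succ_insert (by simp), Finset.sum_union, Finset.sum_image,
    Finset.mul_sum]
  · congr 1
    apply Finset.sum_congr rfl
    intro e he
    rw [Finset.prod_insert]
    intro hN
    have := (Finset.mem_powersetCard.1 he).1 hN
    simp at this
  · intro e he f hf hef
    have h1 : N ∉ e := fun hN => by
      have := (Finset.mem_powersetCard.1 he).1 hN
      simp at this
    have h2 : N ∉ f := fun hN => by
      have := (Finset.mem_powersetCard.1 hf).1 hN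
      simp at this
    rw [← Finset.erase_insert h1, ← Finset.erase_insert h2, hef]
  · rw [Finset.disjoint_left]
    intro e he hf
    obtain ⟨f, _, rfl⟩ := Finset.mem_image.1 hf
    have := (Finset.mem_powersetCard.1 he).1 (Finset.mem_insert_self N f)
    simp at this

lemma lagPoly_one (N : ℕ) (Y : ℕ → ℝ) :
    lagPoly (powersetCard 1 (range N)) Y = ∑ i ∈ range N, Y i := by
  induction N with
  | zero => rw [Finset.powersetCard_eq_empty.2 (by simp)]; simp [lagPoly]
  | succ N ih => rw [lagPoly_succ, ih, Finset.sum_range_succ]; simp [lagPoly]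

lemma lagPoly_two (N : ℕ) (Y : ℕ → ℝ) :
    2 * lagPoly (powersetCard 2 (range N)) Y = (∑ i ∈ range N, Y i)^2 - ∑ i ∈ range N, Y i^2 := by
  induction N with
  | zero => rw [Finset.powersetCard_eq_empty.2 (by simp)]; simp [lagPoly]
  | succ N ih =>
    rw [lagPoly_succ, mul_add, ih, Finset.sum_range_succ, Finset.sum_range_succ, lagPoly_one]; ring

lemma lagPoly_three (N : ℕ) (Y : ℕ → ℝ) :
    6 * lagPoly (powersetCard 3 (range N)) Y = (∑ i ∈ range N, Y i)^3
      - 3 * (∑ i ∈ range N, Y i) * (∑ i ∈ range N, Y i^2) + 2 * ∑ i ∈ range N, Y i^3 := by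
  induction N with
  | zero => rw [Finset.powersetCard_eq_empty.2 (by simp)]; simp [lagPoly]
  | succ N ih =>
    rw [lagPoly_succ, mul_add, ih, Finset.sum_range_succ, Finset.sum_range_succ,
      Finset.sum_range_succ]
    have := lagPoly_two N Y
    linear_combination 3 * Y N * this

lemma prod3 {a b c : ℕ} (hab : a < b) (hbc : b < c) (Y : ℕ → ℝ) :
    ∏ i ∈ ({a, b, c} : Finset ℕ), Y i = Y a * Y b * Y c := by
  rw [Finset.prod_insert, Finset.prod_pair hbc.ne, mul_assoc]
  simp; omega

lemma mem3 {a b c a' b' c' : ℕ} (hab : a < b) (hbc : b < c) (hab' : a' < b') (hbc' : b' < c')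
    (h : ({a, b, c} : Finset ℕ) = {a', b', c'}) : a = a' ∧ b = b' ∧ c = c' := by
  have h1 : a ∈ ({a', b', c'} : Finset ℕ) := by rw [← h]; simp
  have h2 : b ∈ ({a', b', c'} : Finset ℕ) := by rw [← h]; simp
  have h3 : c ∈ ({a', b', c'} : Finset ℕ) := by rw [← h]; simp
  simp only [Finset.mem_insert, Finset.mem_singleton] at h1 h2 h3
  omega

lemma exists3 {e : Finset ℕ} (he : e.card = 3) : ∃ a b c, a < b ∧ b < c ∧ e = {a, b, c} := by
  obtain ⟨x, y, z, hxy, hxz, hyz, rfl⟩ := Finset.card_eq_three.1 he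
  rcases lt_or_gt_of_ne hxy with h1 | h1 <;> rcases lt_or_gt_of_ne hxz with h2 | h2 <;>
    rcases lt_or_gt_of_ne hyz with h3 | h3
  · exact ⟨x, y, z, h1, h3, rfl⟩
  · exact ⟨x, z, y, h2, h3, by ext; simp; tauto⟩
  · omega
  · exact ⟨z, x, y, h2, h1, by ext; simp; tauto⟩
  · exact ⟨y, x, z, h1, h2, by ext; simp; tauto⟩
  · omega
  · exact ⟨y, z, x, h3, h2, by ext; simp; tauto⟩
  · exact ⟨z, y, x, h3, h1, by ext; simp; tauto⟩

lemma dom {E : Finset (Finset ℕ)} (hlc : LeftCompressed E) {a b c a' b' c' : ℕ}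
    (hab : a < b) (hbc : b < c) (hab' : a' < b') (hbc' : b' < c')
    (h1 : a ≤ a') (h2 : b ≤ b') (h3 : c ≤ c') (h : ({a', b', c'} : Finset ℕ) ∈ E) :
    ({a, b, c} : Finset ℕ) ∈ E := by
  have s1 : ({a, b', c'} : Finset ℕ) ∈ E := by
    rcases h1.eq_or_lt with rfl | h1
    · exact h
    · have := hlc _ h a' (by simp) a h1 (by simp; omega)
      convert this using 1
      ext x; simp; omega
  have s2 : ({a, b, c'} : Finset ℕ) ∈ E := by
    rcases h2.eq_or_lt with rfl | h2
    · exact s1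
    · have := hlc _ s1 b' (by simp) b h2 (by simp; omega)
      convert this using 1
      ext x; simp; omega
  rcases h3.eq_or_lt with rfl | h3
  · exact s2
  · have := hlc _ s2 c' (by simp) c h3 (by simp; omega)
    convert this using 1
    ext x; simp; omega

lemma mem_K {a b c t : ℕ} (hab : a < b) (hbc : b < c) (hc : c < t) :
    ({a, b, c} : Finset ℕ) ∈ (range t).powersetCard 3 := by
  rw [Finset.mem_powersetCard]
  constructor
  · intro x; simp; omega
  · exact Finset.card_eq_three.2 ⟨a, b, c, by omega, by omega, by omega, rfl⟩

lemma sum_miss {E T : Finset (Finset ℕ)} {N b : ℕ} (hE : E ⊆ (range (N+2)).powersetCard 3)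
    (hT : T ⊆ (range (N+2)).powersetCard 3) (hTE : ∀ e ∈ T, e ∉ E)
    (hT2 : ∀ e ∈ T, ¬ (N ∈ e ∧ N + 1 ∈ e))
    (hb : ∀ i, b ≤ i → i < N → ({i, N, N+1} : Finset ℕ) ∉ E) {Y : ℕ → ℝ} (hY : ∀ i, 0 ≤ Y i) :
    lagPoly E Y + lagPoly T Y + Y N * Y (N+1) * ∑ i ∈ Ico b N, Y i ≤
      lagPoly ((range (N+2)).powersetCard 3) Y := by
  set M := (Ico b N).image (fun i => ({i, N, N+1} : Finset ℕ)) with hM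
  have hMs : lagPoly M Y = Y N * Y (N+1) * ∑ i ∈ Ico b N, Y i := by
    unfold lagPoly
    rw [hM, Finset.sum_image, Finset.mul_sum]
    · apply Finset.sum_congr rfl
      intro i hi
      rw [prod3 (by simp at hi; omega) (by omega)]; ring
    · intro i hi j hj hij
      simp at hi hj
      exact (mem3 (by omega) (by omega) (by omega) (by omega) hij).1
  have d1 : Disjoint E T := by
    rw [Finset.disjoint_left]; exact fun e h1 h2 => hTE e h2 h1
  have d2 : Disjoint (E ∪ T) M := by
    rw [Finset.disjoint_left]
    intro e h1 h2
    obtain ⟨i, hi, rfl⟩ := Finset.mem_image.1 h2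
    simp at hi
    rcases Finset.mem_union.1 h1 with h1 | h1
    · exact hb i hi.1 hi.2 h1
    · exact hT2 _ h1 (by simp)
  rw [← hMs]
  unfold lagPoly
  rw [← Finset.sum_union d1, ← Finset.sum_union d2]
  apply Finset.sum_le_sum_of_subset_of_nonneg
  · refine Finset.union_subset (Finset.union_subset hE hT) ?_
    intro e h2
    obtain ⟨i, hi, rfl⟩ := Finset.mem_image.1 h2
    simp at hi
    exact mem_K (by omega) (by omega) (by omega)
  · intro e _ _
    exact Finset.prod_nonneg (fun i _ => hY i)

lemma key {E T : Finset (Finset ℕ)} {N b : ℕ} (hbN : b ≤ N) (hE : E ⊆ (range (N+2)).powersetCard 3)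
    (hT : T ⊆ (range (N+2)).powersetCard 3) (hTE : ∀ e ∈ T, e ∉ E)
    (hT2 : ∀ e ∈ T, ¬ (N ∈ e ∧ N + 1 ∈ e))
    (hb : ∀ i, b ≤ i → i < N → ({i, N, N+1} : Finset ℕ) ∉ E) {Y : ℕ → ℝ} (hY : ∀ i, 0 ≤ Y i)
    (hs : ∑ i ∈ range N, Y i + (Y N + Y (N+1)) = (N:ℝ) + 1) :
    6 * lagPoly E Y ≤ ((N:ℝ)+1) * N * (N-1) - (∑ i ∈ range N, gg ((N:ℝ)+1) (Y i)
      + gg ((N:ℝ)+1) (Y N + Y (N+1)) + 6 * lagPoly T Y - 6 * (Y N * Y (N+1) * ∑ i ∈ range b, Y i)) := by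
  have h1 := sum_miss hE hT hTE hT2 hb hY
  have h2 : lagPoly ((range (N+2)).powersetCard 3) Y = lagPoly ((range N).powersetCard 3) Y
     + (Y N + Y (N+1)) * lagPoly ((range N).powersetCard 2) Y + Y N * Y (N+1) * ∑ i ∈ range N, Y i := by
    rw [lagPoly_succ, lagPoly_succ, lagPoly_succ, lagPoly_one]; ring
  have h3 : ∑ i ∈ range N, gg ((N:ℝ)+1) (Y i) = -2 * ∑ i ∈ range N, Y i^3 + 3*((N:ℝ)+1) * ∑ i ∈ range N, Y i^2
      - 6*N * ∑ i ∈ range N, Y i + N * (3*N-1) := by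
    have : ∀ i ∈ range N, gg ((N:ℝ)+1) (Y i) = -2 * Y i^3 + 3*((N:ℝ)+1) * Y i^2
      - 6*N * Y i + (3*N-1) := fun i _ => by unfold gg; ring
    rw [Finset.sum_congr rfl this]
    simp [Finset.sum_add_distrib, Finset.sum_sub_distrib, Finset.mul_sum]
    ring
  have h4 := Finset.sum_range_add_sum_Ico Y hbN
  have e2 := lagPoly_two N Y
  have e3 := lagPoly_three N Y
  rw [h2] at h1
  rw [h3]
  set s := ∑ i ∈ range N, Y i
  set p2 := ∑ i ∈ range N, Y i^2
  set p3 := ∑ i ∈ range N, Y i^3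
  set P := Y N
  set Q := Y (N+1)
  obtain ⟨Z, hZ⟩ : ∃ Z, Z = P + Q := ⟨_, rfl⟩
  have hN : (N:ℝ) = s + Z - 1 := by linarith
  have h5 : 6*(lagPoly E Y + lagPoly T Y + P * Q * ∑ i ∈ Ico b N, Y i) ≤ 
    (s^3-3*s*p2+2*p3) + 3*Z*(s^2-p2) + 6*(P*Q*s) := by
    rw [← e2, ← e3, hZ]; linarith
  rw [← hZ, hN]
  unfold gg
  have h6 : P * Q * s = P*Q * ∑ i ∈ range b, Y i + P * Q * ∑ i ∈ Ico b N, Y i := by rw [← h4]; ring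
  nlinarith

lemma pick_le {N : ℕ} {Y : ℕ → ℝ} {n : ℝ} (hn : 4 ≤ n) (hYn : ∀ i ∈ range N, Y i ≤ n)
    (s : Finset ℕ) (hs : s ⊆ range N) :
    ∑ i ∈ s, gg n (Y i) ≤ ∑ i ∈ range N, gg n (Y i) :=
  Finset.sum_le_sum_of_subset_of_nonneg hs (fun i hi _ => gg_nonneg hn (hYn i hi))

lemma bound (N : ℕ) (E : Finset (Finset ℕ)) (hN : 3 ≤ N)
    (hE : E ⊆ (range (N+2)).powersetCard 3) (hlc : LeftCompressed E)
    (hcard : E.card ≤ (N+1).choose 3 + N.choose 2)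
    (h0 : ({N-2, N-1, N} : Finset ℕ) ∉ E)
    (h3 : 3 < N → ({3, N, N+1} : Finset ℕ) ∉ E)
    {Y : ℕ → ℝ} (hY : ∀ i, 0 ≤ Y i)
    (hs : ∑ i ∈ range N, Y i + (Y N + Y (N+1)) = (N:ℝ) + 1) :
    6 * lagPoly E Y ≤ ((N:ℝ)+1) * N * (N-1) - 1/200 := by
  have hNr : (3:ℝ) ≤ N := by exact_mod_cast hN
  have hYn : ∀ i ∈ range N, Y i ≤ (N:ℝ) + 1 := by
    intro i hi
    have := Finset.single_le_sum (f := Y) (fun i _ => hY i) hi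
    linarith [hY N, hY (N+1)]
  have h1 : ({N-2, N-1, N+1} : Finset ℕ) ∉ E := fun h =>
    h0 (dom hlc (by omega) (by omega) (by omega) (by omega) le_rfl le_rfl (by omega) h)
  have h2 : ({N-2, N, N+1} : Finset ℕ) ∉ E := fun h =>
    h1 (dom hlc (by omega) (by omega) (by omega) (by omega) le_rfl (by omega) le_rfl h)
  have up : ∀ b, b < N → ({b, N, N+1} : Finset ℕ) ∉ E → ∀ i, b ≤ i → i < N →
      ({i, N, N+1} : Finset ℕ) ∉ E := fun b hbN hb i hi hiN h =>
    hb (dom hlc (by omega) (by omega) (by omega) (by omega) hi le_rfl le_rfl h)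
  have hne : ({N-2, N-1, N} : Finset ℕ) ≠ {N-2, N-1, N+1} := fun h => by
    have := mem3 (by omega) (by omega) (by omega) (by omega) h
    omega
  set T : Finset (Finset ℕ) := {{N-2, N-1, N}, {N-2, N-1, N+1}} with hT
  have hTs : lagPoly T Y = Y (N-2) * Y (N-1) * (Y N + Y (N+1)) := by
    unfold lagPoly
    rw [hT, Finset.sum_pair hne, prod3 (by omega) (by omega), prod3 (by omega) (by omega)]; ring
  have hTK : T ⊆ (range (N+2)).powersetCard 3 := by
    intro e he
    simp only [hT, Finset.mem_insert, Finset.mem_singleton] at he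
    rcases he with rfl | rfl
    · exact mem_K (by omega) (by omega) (by omega)
    · exact mem_K (by omega) (by omega) (by omega)
  have hTE : ∀ e ∈ T, e ∉ E := by
    intro e he
    simp only [hT, Finset.mem_insert, Finset.mem_singleton] at he
    rcases he with rfl | rfl
    · exact h0
    · exact h1
  have hT2 : ∀ e ∈ T, ¬ (N ∈ e ∧ N + 1 ∈ e) := by
    intro e he
    simp only [hT, Finset.mem_insert, Finset.mem_singleton] at he
    rcases he with rfl | rfl <;> simp <;> omega
  by_cases hN3 : N = 3
  · subst hN3
    have k := key (b := 1) (by omega) hE hTK hTE hT2 (up 1 (by omega) h2) hY hs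
    rw [hTs] at k
    simp only [Finset.sum_range_succ, Finset.sum_range_zero] at k hs
    norm_num at k hs ⊢
    have := ineq1 (hY 0) (hY 1) (hY 2) (hY 3) (hY 4) (by linarith)
    linarith
  have hN4 : 4 ≤ N := by omega
  have hN4r : (4:ℝ) ≤ N := by exact_mod_cast hN4
  by_cases hb2 : ({2, N, N+1} : Finset ℕ) ∈ E
  swap
  · have k := key (b := 2) (by omega) hE hTK hTE hT2 (up 2 (by omega) hb2) hY hs
    rw [hTs] at k
    have hsub : ({0, 1, N-2, N-1} : Finset ℕ) ⊆ range N := by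
      intro x; simp; omega
    have p1 := pick_le (n := (N:ℝ)+1) (by linarith) hYn _ hsub
    have p2 := Finset.sum_le_sum_of_subset_of_nonneg (f := Y) hsub (fun i _ _ => hY i)
    have hd : ∀ f : ℕ → ℝ, ∑ i ∈ ({0, 1, N-2, N-1} : Finset ℕ), f i =
        f 0 + (f 1 + (f (N-2) + f (N-1))) := by
      intro f
      rw [Finset.sum_insert (by simp; omega), Finset.sum_insert (by simp; omega),
        Finset.sum_pair (by omega)]
    rw [hd] at p1 p2
    simp only [Finset.sum_range_succ _ 1, Finset.sum_range_one] at k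
    have := ineq2 (n := (N:ℝ)+1) (by linarith) (hY 0) (hY 1) (hY (N-2)) (hY (N-1)) (hY N) (hY (N+1))
      (by linarith)
    linarith
  have hN5 : 5 ≤ N := by
    by_contra hlt
    have : N = 4 := by omega
    subst this
    exact h2 hb2
  have hA : ({N-3, N-1, N+1} : Finset ℕ) ∉ E := by
    intro hA
    have hsub : (range (N+2)).powersetCard 3 ⊆
        E ∪ (T ∪ (Ico 3 N).image (fun i => ({i, N, N+1} : Finset ℕ))) := by
      intro e he
      rw [Finset.mem_powersetCard] at he
      obtain ⟨a, b, c, hab, hbc, rfl⟩ := exists3 he.2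
      have hc : c < N + 2 := by
        have : c ∈ range (N+2) := he.1 (by simp)
        simpa using this
      simp only [Finset.mem_union, hT, Finset.mem_insert, Finset.mem_singleton, Finset.mem_image,
        Finset.mem_Ico]
      by_cases c1 : b = N
      · have c2 : c = N + 1 := by omega
        subst c2; subst c1
        by_cases ha : 3 ≤ a
        · right; right; exact ⟨a, ⟨ha, hab⟩, rfl⟩
        · left
          exact dom hlc hab hbc (by omega) (by omega) (by omega) le_rfl le_rfl hb2
      · by_cases c2 : a = N - 2
        · have c3 : b = N - 1 := by omega
          subst c2; subst c3
          have : c = N ∨ c = N + 1 := by omega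
          rcases this with rfl | rfl
          · right; left; left; rfl
          · right; left; right; rfl
        · left
          exact dom hlc hab hbc (by omega) (by omega) (by omega) (by omega) (by omega) hA
    have c1 := Finset.card_le_card hsub
    have c2 := Finset.card_union_le E (T ∪ (Ico 3 N).image (fun i => ({i, N, N+1} : Finset ℕ)))
    have c3 := Finset.card_union_le T ((Ico 3 N).image (fun i => ({i, N, N+1} : Finset ℕ)))
    have c4 : ((Ico 3 N).image (fun i => ({i, N, N+1} : Finset ℕ))).card ≤ N - 3 := by
      have := Finset.card_image_le (s := Ico 3 N) (f := fun i => ({i, N, N+1} : Finset ℕ))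
      simpa using this
    have c5 : T.card ≤ 2 := Finset.card_le_two
    rw [Finset.card_powersetCard, Finset.card_range] at c1
    have c6 : (N+2).choose 3 = (N+1).choose 2 + (N+1).choose 3 := Nat.choose_succ_succ (N+1) 2
    have c7 : (N+1).choose 2 = N.choose 1 + N.choose 2 := Nat.choose_succ_succ N 1
    rw [Nat.choose_one_right] at c7
    omega
  have hN6 : 6 ≤ N := by
    by_contra hlt
    have : N = 5 := by omega
    subst this
    exact hA (dom hlc (by omega) (by omega) (by omega) (by omega) le_rfl (by omega) le_rfl hb2)
  have hN6r : (6:ℝ) ≤ N := by exact_mod_cast hN6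
  have hAT : ({N-3, N-1, N+1} : Finset ℕ) ∉ T := by
    simp only [hT, Finset.mem_insert, Finset.mem_singleton, not_or]
    constructor
    · intro h
      have := mem3 (by omega) (by omega) (by omega) (by omega) h
      omega
    · intro h
      have := mem3 (by omega) (by omega) (by omega) (by omega) h
      omega
  have hTs' : lagPoly (insert {N-3, N-1, N+1} T) Y =
      Y (N-3) * Y (N-1) * Y (N+1) + Y (N-2) * Y (N-1) * (Y N + Y (N+1)) := by
    rw [← hTs]
    unfold lagPoly
    rw [Finset.sum_insert hAT, prod3 (by omega) (by omega)]
  have k := key (b := 3) (T := insert {N-3, N-1, N+1} T) (by omega) hE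
    (by
      intro e he
      rcases Finset.mem_insert.1 he with rfl | he
      · exact mem_K (by omega) (by omega) (by omega)
      · exact hTK he)
    (by
      intro e he
      rcases Finset.mem_insert.1 he with rfl | he
      · exact hA
      · exact hTE e he)
    (by
      intro e he
      rcases Finset.mem_insert.1 he with rfl | he
      · simp; omega
      · exact hT2 e he) (up 3 (by omega) (h3 (by omega))) hY hs
  rw [hTs'] at k
  have hsub : ({0, 1, 2, N-3, N-2, N-1} : Finset ℕ) ⊆ range N := by
    intro x; simp; omega
  have p1 := pick_le (n := (N:ℝ)+1) (by linarith) hYn _ hsub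
  have p2 := Finset.sum_le_sum_of_subset_of_nonneg (f := Y) hsub (fun i _ _ => hY i)
  have hd : ∀ f : ℕ → ℝ, ∑ i ∈ ({0, 1, 2, N-3, N-2, N-1} : Finset ℕ), f i =
      f 0 + (f 1 + (f 2 + (f (N-3) + (f (N-2) + f (N-1))))) := by
    intro f
    rw [Finset.sum_insert (by simp; omega), Finset.sum_insert (by simp; omega),
      Finset.sum_insert (by simp; omega), Finset.sum_insert (by simp; omega),
      Finset.sum_pair (by omega)]
  rw [hd] at p1 p2
  simp only [Finset.sum_range_succ _ 2, Finset.sum_range_succ _ 1, Finset.sum_range_one] at k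
  have := ineq3 (n := (N:ℝ)+1) (by linarith) (hY 0) (hY 1) (hY 2) (hY (N-3)) (hY (N-2)) (hY (N-1))
    (hY N) (hY (N+1)) (by linarith)
  linarith

lemma lagPoly_mono {E : Finset (Finset ℕ)} {w w' : ℕ → ℝ} (hw : ∀ i, 0 ≤ w i)
    (h : ∀ i, w i ≤ w' i) : lagPoly E w ≤ lagPoly E w' :=
  Finset.sum_le_sum (fun _ _ => Finset.prod_le_prod (fun i _ => hw i) (fun i _ => h i))

lemma lagPoly_smul {E : Finset (Finset ℕ)} {t : ℕ} (hE : E ⊆ (range t).powersetCard 3)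
    (c : ℝ) (w : ℕ → ℝ) : lagPoly E (fun i => c * w i) = c^3 * lagPoly E w := by
  unfold lagPoly
  rw [Finset.mul_sum]
  apply Finset.sum_congr rfl
  intro e he
  rw [Finset.prod_mul_distrib, Finset.prod_const, (Finset.mem_powersetCard.1 (hE he)).2]

lemma weight_le_one {k : ℕ} {w : ℕ → ℝ} (h : IsWeighting k w) (s : Finset ℕ) :
    ∑ i ∈ s, w i ≤ 1 := by
  obtain ⟨h1, h2, h3⟩ := h
  rw [← h3, ← Finset.sum_filter_add_sum_filter_not s (fun i => i < k)]
  have : ∑ i ∈ s.filter (fun i => ¬ i < k), w i = 0 :=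
    Finset.sum_eq_zero (fun i hi => h2 i (by simp at hi; omega))
  rw [this, add_zero]
  exact Finset.sum_le_sum_of_subset_of_nonneg (by intro x; simp) (fun i _ _ => h1 i)

lemma lag_bdd (E : Finset (Finset ℕ)) :
    BddAbove {x | ∃ n w, IsWeighting n w ∧ x = lagPoly E w} := by
  refine ⟨E.card, ?_⟩
  rintro x ⟨k, w, hw, rfl⟩
  unfold lagPoly
  calc ∑ e ∈ E, ∏ i ∈ e, w i ≤ ∑ e ∈ E, (1:ℝ) := by
        apply Finset.sum_le_sum
        intro e _
        apply Finset.prod_le_one (fun i _ => hw.1 i)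
        intro i _
        simpa using weight_le_one hw {i}
    _ = E.card := by simp

lemma complete_le (n : ℕ) (hn : 0 < n) :
    (n.choose 3 : ℝ) / n^3 ≤ lag (completeG n 3) := by
  apply le_csSup (lag_bdd _)
  refine ⟨n, fun i => if i < n then 1/(n:ℝ) else 0, ⟨?_, ?_, ?_⟩, ?_⟩
  · intro i; dsimp only; split_ifs <;> positivity
  · intro i hi; simp; omega
  · rw [Finset.sum_congr rfl (g := fun _ => 1/(n:ℝ))]
    · have : (n:ℝ) ≠ 0 := by positivity
      simp [this]
    · intro i hi; simp at hi; simp [hi]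
  · unfold lagPoly completeG
    have : ∀ e ∈ (range n).powersetCard 3, ∏ i ∈ e, (if i < n then 1/(n:ℝ) else 0) = 1/(n:ℝ)^3 := by
      intro e he
      rw [Finset.mem_powersetCard] at he
      rw [Finset.prod_congr rfl (g := fun _ => 1/(n:ℝ))]
      · rw [Finset.prod_const, he.2]; simp
      · intro i hi
        have := he.1 hi
        simp at this; simp [this]
    rw [Finset.sum_congr rfl this]
    simp [div_eq_mul_inv]

/-- A left-compressed 3-graph on [t] with m edges, no clique of order t-1, and
|E_{(t-1)t}| ≤ 3 satisfies λ(G) < λ([t-1]^{(3)}). (Vertices 0,…,t-1.) -/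
theorem stmt_12 (m t : ℕ) (hm : 0 < m) (ht : 0 < t)
    (h₁ : (t - 1).choose 3 ≤ m)
    (h₂ : m ≤ (t - 1).choose 3 + (t - 2).choose 2)
    (E : Finset (Finset ℕ)) (hE : E ⊆ (Finset.range t).powersetCard 3)
    (hmE : E.card = m) (hlc : LeftCompressed E)
    (hnoK : ¬ ∃ s : Finset ℕ, s.card = t - 1 ∧ s.powersetCard 3 ⊆ E)
    (hb : ((Finset.range (t - 2)).filter
        (fun i => ({i, t - 2, t - 1} : Finset ℕ) ∈ E)).card ≤ 3) :
    lag E < lag (completeG (t - 1) 3) := by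
  obtain ⟨N, rfl | rfl⟩ : ∃ N, t = N + 2 ∨ t = 1 := by
    rcases Nat.lt_or_ge t 2 with h | h
    · exact ⟨0, Or.inr (by omega)⟩
    · exact ⟨t - 2, Or.inl (by omega)⟩
  swap
  · simp at h₂; omega
  have e1 : N + 2 - 1 = N + 1 := by omega
  have e2 : N + 2 - 2 = N := by omega
  rw [e1] at h₁ h₂ hnoK ⊢
  rw [e2] at h₂
  simp only [e1, e2] at hb
  have hN2 : 2 ≤ N := by
    by_contra hlt
    have : N = 0 ∨ N = 1 := by omega
    rcases this with rfl | rfl <;> simp [Nat.choose] at h₂ <;> omega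
  have h0 : ({N-2, N-1, N} : Finset ℕ) ∉ E := by
    intro h
    apply hnoK
    refine ⟨range (N+1), by simp, ?_⟩
    intro e he
    rw [Finset.mem_powersetCard] at he
    obtain ⟨a, b, c, hab, hbc, rfl⟩ := exists3 he.2
    have hc : c < N + 1 := by
      have : c ∈ range (N+1) := he.1 (by simp)
      simpa using this
    exact dom hlc hab hbc (by omega) (by omega) (by omega) (by omega) (by omega) h
  have hN : 3 ≤ N := by
    by_contra hlt
    have : N = 2 := by omega
    subst this
    have : E.Nonempty := Finset.card_pos.1 (by omega)
    obtain ⟨e, he⟩ := this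
    obtain ⟨a, b, c, hab, hbc, rfl⟩ := exists3 (Finset.mem_powersetCard.1 (hE he)).2
    exact h0 (dom hlc (by omega) (by omega) hab hbc (by omega) (by omega) (by omega) he)
  have h3 : 3 < N → ({3, N, N+1} : Finset ℕ) ∉ E := by
    intro h3N h3
    have hsub : range 4 ⊆ (Finset.range N).filter
        (fun i => ({i, N, N+1} : Finset ℕ) ∈ E) := by
      intro i hi
      simp only [Finset.mem_range, Finset.mem_filter] at hi ⊢
      exact ⟨by omega, dom hlc (by omega) (by omega) (by omega) (by omega) (by omega) le_rfl le_rfl h3⟩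
    have := Finset.card_le_card hsub
    rw [Finset.card_range] at this
    omega
  have hn0 : (0:ℝ) < (N:ℝ) + 1 := by positivity
  have hch : (((N+1).choose 3 : ℕ) : ℝ) * 6 = ((N:ℝ)+1) * N * (N-1) := by
    have h := Nat.descFactorial_eq_factorial_mul_choose (N+1) 3
    have h' : (N+1).descFactorial 3 = (N+1) * N * (N-1) := by
      simp [Nat.descFactorial_succ]; ring
    rw [h'] at h
    have h4 : ((3).factorial : ℕ) = 6 := rfl
    rw [h4] at h
    have h5 : (((N+1) * N * (N-1) : ℕ) : ℝ) = ((6 * (N+1).choose 3 : ℕ) : ℝ) := by rw [h]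
    rw [Nat.cast_mul, Nat.cast_sub (by omega)] at h5
    push_cast at h5
    linarith
  refine lt_of_lt_of_le ?_ (complete_le (N+1) (by omega))
  have hlt : ((((N:ℝ)+1) * N * (N-1) - 1/200)/6) / ((N:ℝ)+1)^3 < (((N+1).choose 3 : ℕ) : ℝ) / ((N+1 : ℕ) : ℝ)^3 := by
    push_cast
    apply div_lt_div_of_pos_right _ (by positivity)
    linarith
  refine lt_of_le_of_lt ?_ hlt
  apply csSup_le
  · refine ⟨_, 1, fun i => if i = 0 then 1 else 0, ⟨?_, ?_, ?_⟩, rfl⟩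
    · intro i; dsimp only; split_ifs <;> norm_num
    · intro i hi; simp; omega
    · simp
  rintro x ⟨k, w, hw, rfl⟩
  have hs1 := weight_le_one hw (range (N+2))
  set s := ∑ i ∈ range (N+2), w i with hsdef
  let w' : ℕ → ℝ := fun i => w i + if i = 0 then 1 - s else 0
  have hww : ∀ i, w i ≤ w' i := by
    intro i
    simp only [w']
    split_ifs <;> linarith
  have hw'0 : ∀ i, 0 ≤ w' i := fun i => (hw.1 i).trans (hww i)
  have hw's : ∑ i ∈ range (N+2), w' i = 1 := by
    simp only [w']
    rw [Finset.sum_add_distrib, ← hsdef]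
    simp
  have hb := bound N E hN hE hlc (by omega) h0 h3 (Y := fun i => ((N:ℝ)+1) * w' i)
    (fun i => mul_nonneg hn0.le (hw'0 i)) (by
      rw [Finset.sum_range_succ, Finset.sum_range_succ] at hw's
      rw [← Finset.mul_sum]
      linear_combination ((N:ℝ)+1) * hw's)
  rw [lagPoly_smul hE] at hb
  refine (lagPoly_mono hw.1 hww).trans ?_
  rw [le_div_iff₀ (by positivity)]
  linarith
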